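/- Let (Ω, F, P) be a probability space with a filtration (F_t) for t = 0, 1, …, T, let N ≥ 1 be an integer, and for each i ∈ {1, …, N} let (D^i_t)_{t=0}^{T} be an adapted process of nonnegative real random variables. Let D > 0, η > 0, γ ∈ (0, 1), and τ ∈ (0, 1) be such that for every i: D^i_0 ≤ D almost surely; D^i_{t+1} ≤ D^i_t almost surely for every t < T; and for every t < T, P[D^i_{t+1} ≤ max((1−γ)·D^i_t, η) | F_t] ≥ 1/2 almost surely. If (1 − γ)^{⌈T/4⌉}·D ≤ η and T ≥ 16·log(N/τ), then P[there exists i ∈ {1, …, N} with D^i_T > η] ≤ τ; in particular, with probability at least 1 − τ, D^i_T ≤ η for every i. -/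

import Mathlib

open MeasureTheory ProbabilityTheory
open scoped ENNReal

/-- Expectation of the exponential weight decays by `3/4` at each step. -/
theorem aux_weight {Ω : Type*} {m : MeasurableSpace Ω} (P : Measure Ω) [IsProbabilityMeasure P]
    (T : ℕ) (ℱ : Filtration ℕ m) (A : ℕ → Set Ω)
    (hA : ∀ t, t < T → MeasurableSet[ℱ (t + 1)] (A t))
    (hcond : ∀ t, t < T → ∀ᵐ ω ∂P, (1 : ℝ) / 2 ≤
      (P[Set.indicator (A t) (fun _ => (1 : ℝ)) | ℱ t]) ω)
    (Z : ℕ → Ω → ℝ) (hZ0 : ∀ ω, Z 0 ω = 1)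
    (hZ : ∀ t ω, Z (t + 1) ω = Z t ω * (1 - 1 / 2 * (A t).indicator (fun _ => (1 : ℝ)) ω)) :
    ∀ t, t ≤ T → StronglyMeasurable[ℱ t] (Z t) ∧ (∀ ω, 0 ≤ Z t ω ∧ Z t ω ≤ 1) ∧
      Integrable (Z t) P ∧ ∫ ω, Z t ω ∂P ≤ (3 / 4) ^ t := by
  intro t
  induction t with
  | zero =>
    intro _
    have h : Z 0 = fun _ => (1 : ℝ) := funext hZ0
    rw [h]
    refine ⟨stronglyMeasurable_const, by simp, integrable_const _, by simp⟩
  | succ t ih =>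
    intro ht
    obtain ⟨h1, h2, h3, h4⟩ := ih (by omega)
    have hAm := hA t (by omega)
    have hI01 : ∀ ω, 0 ≤ (A t).indicator (fun _ => (1 : ℝ)) ω ∧
        (A t).indicator (fun _ => (1 : ℝ)) ω ≤ 1 := by
      intro ω
      by_cases h : ω ∈ A t <;> simp [h]
    have hIs : StronglyMeasurable[ℱ (t + 1)] ((A t).indicator (fun _ => (1 : ℝ))) :=
      StronglyMeasurable.indicator stronglyMeasurable_const hAm
    have hZe : Z (t + 1) = fun ω =>
        Z t ω * (1 - 1 / 2 * (A t).indicator (fun _ => (1 : ℝ)) ω) := funext (hZ t)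
    have hsm : StronglyMeasurable[ℱ (t + 1)] (Z (t + 1)) := by
      rw [hZe]
      exact (h1.mono (ℱ.mono (Nat.le_succ t))).mul
        (stronglyMeasurable_const.sub (stronglyMeasurable_const.mul hIs))
    have hb : ∀ ω, 0 ≤ Z (t + 1) ω ∧ Z (t + 1) ω ≤ 1 := by
      intro ω
      rw [hZ]
      obtain ⟨a, b⟩ := h2 ω
      obtain ⟨c, d⟩ := hI01 ω
      exact ⟨mul_nonneg a (by linarith), mul_le_one₀ b (by linarith) (by linarith)⟩
    have hint : Integrable (Z (t + 1)) P := by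
      refine Integrable.of_bound (hsm.mono (ℱ.le _)).aestronglyMeasurable 1 ?_
      filter_upwards with ω
      rw [Real.norm_eq_abs, abs_of_nonneg (hb ω).1]
      exact (hb ω).2
    refine ⟨hsm, hb, hint, ?_⟩
    have hIint : Integrable ((A t).indicator (fun _ => (1 : ℝ))) P :=
      (integrable_const _).indicator (ℱ.le _ _ hAm)
    have hZI : Integrable (Z t * (A t).indicator (fun _ => (1 : ℝ))) P := by
      refine Integrable.of_bound
        (((h1.mono (ℱ.le _)).mul (hIs.mono (ℱ.le _))).aestronglyMeasurable) 1 ?_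
      filter_upwards with ω
      obtain ⟨a, b⟩ := h2 ω
      obtain ⟨c, d⟩ := hI01 ω
      rw [Pi.mul_apply, Real.norm_eq_abs, abs_of_nonneg (mul_nonneg a c)]
      exact mul_le_one₀ b c d
    have hce := condExp_mul_of_stronglyMeasurable_left (m := ℱ t) h1 hZI hIint
    have key : 1 / 2 * ∫ ω, Z t ω ∂P ≤
        ∫ ω, (Z t * (A t).indicator (fun _ => (1 : ℝ))) ω ∂P := by
      rw [← integral_condExp (ℱ.le t) (f := Z t * (A t).indicator (fun _ => (1 : ℝ))),
        ← integral_const_mul]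
      refine integral_mono_ae (h3.const_mul _) integrable_condExp ?_
      filter_upwards [hce, hcond t (by omega)] with ω e1 e2
      rw [e1, Pi.mul_apply]
      nlinarith [(h2 ω).1]
    have : ∫ ω, Z (t + 1) ω ∂P = ∫ ω, Z t ω ∂P -
        1 / 2 * ∫ ω, (Z t * (A t).indicator (fun _ => (1 : ℝ))) ω ∂P := by
      rw [← integral_const_mul, ← integral_sub h3 (hZI.const_mul _)]
      congr 1
      ext ω
      rw [hZ, Pi.mul_apply]
      ring
    rw [this, pow_succ]
    linarith

/-- Numerical bound. -/
theorem aux_num (T k : ℕ) (hk : 4 * k ≤ T) :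
    (3 / 4 : ℝ) ^ T * 2 ^ k ≤ Real.exp (-(T : ℝ) / 16) := by
  have h4 : ((3 / 4 : ℝ) ^ T * 2 ^ k) ^ 4 ≤ (Real.exp (-(T : ℝ) / 16)) ^ 4 := by
    have e1 : (Real.exp (-(T : ℝ) / 16)) ^ 4 = (Real.exp (-(1 / 4))) ^ T := by
      rw [← Real.exp_nat_mul, ← Real.exp_nat_mul]
      congr 1
      push_cast
      ring
    have e2 : (3 / 4 : ℝ) ≤ Real.exp (-(1 / 4)) := by
      have := Real.add_one_le_exp (-(1 / 4) : ℝ)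
      linarith
    calc ((3 / 4 : ℝ) ^ T * 2 ^ k) ^ 4 = ((3 / 4 : ℝ) ^ 4) ^ T * 2 ^ (4 * k) := by
          rw [mul_pow, ← pow_mul, ← pow_mul, ← pow_mul, mul_comm T 4, mul_comm k 4]
      _ ≤ ((3 / 4 : ℝ) ^ 4) ^ T * 2 ^ T := by
          gcongr
          norm_num
      _ = ((3 / 4 : ℝ) ^ 4 * 2) ^ T := by rw [mul_pow]
      _ ≤ (3 / 4 : ℝ) ^ T := by
          gcongr
          norm_num
      _ ≤ _ := by
          rw [e1]
          gcongr
  exact le_of_pow_le_pow_left₀ (by norm_num) (Real.exp_pos _).le h4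

/-- The bound for a single process. -/
theorem aux_single {Ω : Type*} {m : MeasurableSpace Ω} (P : Measure Ω) [IsProbabilityMeasure P]
    (T : ℕ) (ℱ : Filtration ℕ m)
    (D : ℕ → Ω → ℝ)
    (hmeas : ∀ t, t ≤ T → StronglyMeasurable[ℱ t] (D t))
    (Dmax η γ : ℝ) (hDmax : 0 < Dmax) (hγ0 : 0 < γ) (hγ1 : γ < 1)
    (h0 : ∀ᵐ ω ∂P, D 0 ω ≤ Dmax)
    (hmono : ∀ t, t < T → ∀ᵐ ω ∂P, D (t + 1) ω ≤ D t ω)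
    (hcond : ∀ t, t < T → ∀ᵐ ω ∂P, (1 : ℝ) / 2 ≤
      (P[Set.indicator {ω' | D (t + 1) ω' ≤ max ((1 - γ) * D t ω') η}
          (fun _ => (1 : ℝ)) | ℱ t]) ω)
    (hcontract : (1 - γ) ^ (⌈(T : ℝ) / 4⌉₊) * Dmax ≤ η) :
    P {ω | η < D T ω} ≤ ENNReal.ofReal (Real.exp (-(T : ℝ) / 16)) := by
  classical
  set A : ℕ → Set Ω := fun t => {ω' | D (t + 1) ω' ≤ max ((1 - γ) * D t ω') η} with hAdef
  have hA : ∀ t, t < T → MeasurableSet[ℱ (t + 1)] (A t) := by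
    intro t ht
    have a1 : Measurable[ℱ (t + 1)] (D (t + 1)) := (hmeas (t + 1) ht).measurable
    have a2 : Measurable[ℱ (t + 1)] (D t) :=
      ((hmeas t ht.le).mono (ℱ.mono (Nat.le_succ t))).measurable
    exact measurableSet_le a1
      ((measurable_const.mul a2).max measurable_const)
  let Z : ℕ → Ω → ℝ := fun t ω =>
    ∏ s ∈ Finset.range t, (1 - 1 / 2 * (A s).indicator (fun _ => (1 : ℝ)) ω)
  have hZ : ∀ t ω, Z (t + 1) ω = Z t ω * (1 - 1 / 2 * (A t).indicator (fun _ => (1 : ℝ)) ω) :=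
    fun t ω => Finset.prod_range_succ _ _
  have hZ0 : ∀ ω, Z 0 ω = 1 := fun ω => Finset.prod_range_zero _
  obtain ⟨_, h2, h3, h4⟩ := aux_weight P T ℱ A hA hcond Z hZ0 hZ T le_rfl
  set K := ⌈(T : ℝ) / 4⌉₊ with hK
  have hK4 : 4 * (K - 1) ≤ T := by
    have := Nat.ceil_lt_add_one (a := (T : ℝ) / 4) (by positivity)
    rw [← hK] at this
    have : 4 * (K : ℝ) < T + 4 := by linarith
    have : 4 * K < T + 4 := by exact_mod_cast this
    omega
  have hmono' : ∀ᵐ ω ∂P, ∀ t, t < T → D (t + 1) ω ≤ D t ω := by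
    rw [ae_all_iff]
    intro t
    by_cases ht : t < T
    · filter_upwards [hmono t ht] with ω h _ using h
    · filter_upwards with ω h using absurd h ht
  have hdet : ∀ᵐ ω ∂P, η < D T ω → (1 / 2 : ℝ) ^ (K - 1) ≤ Z T ω := by
    filter_upwards [h0, hmono'] with ω b0 bm
    have main : ∀ t, t ≤ T → η < D t ω →
        ∃ S : ℕ, Z t ω = (1 / 2) ^ S ∧ D t ω ≤ (1 - γ) ^ S * Dmax := by
      intro t
      induction t with
      | zero =>
        intro _ _
        exact ⟨0, by simp [hZ0], by simpa using b0⟩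
      | succ t ih =>
        intro ht hlt
        obtain ⟨S, s1, s2⟩ := ih (by omega) (hlt.trans_le (bm t ht))
        by_cases hm : ω ∈ A t
        · refine ⟨S + 1, ?_, ?_⟩
          · rw [hZ, s1, Set.indicator_of_mem hm, pow_succ]
            norm_num
          · have hm' : D (t + 1) ω ≤ max ((1 - γ) * D t ω) η := hm
            rcases le_max_iff.1 hm' with h | h
            · calc D (t + 1) ω ≤ (1 - γ) * D t ω := h
                _ ≤ (1 - γ) * ((1 - γ) ^ S * Dmax) :=
                  mul_le_mul_of_nonneg_left s2 (by linarith)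
                _ = _ := by ring
            · linarith
        · refine ⟨S, ?_, (bm t ht).trans s2⟩
          rw [hZ, s1, Set.indicator_of_notMem hm]
          norm_num
    intro hlt
    obtain ⟨S, s1, s2⟩ := main T le_rfl hlt
    have hS : S < K := by
      by_contra hcon
      have : (1 - γ) ^ S ≤ (1 - γ) ^ K :=
        pow_le_pow_of_le_one (by linarith) (by linarith) (not_lt.1 hcon)
      have := mul_le_mul_of_nonneg_right this hDmax.le
      linarith
    rw [s1]
    exact pow_le_pow_of_le_one (by norm_num) (by norm_num) (by omega)
  have hmk := mul_meas_ge_le_integral_of_nonneg (μ := P) (f := Z T)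
    (Filter.Eventually.of_forall fun ω => (h2 ω).1) h3 ((1 / 2 : ℝ) ^ (K - 1))
  have hle : P {ω | η < D T ω} ≤ P {ω | (1 / 2 : ℝ) ^ (K - 1) ≤ Z T ω} :=
    measure_mono_ae hdet
  have hreal : P.real {ω | (1 / 2 : ℝ) ^ (K - 1) ≤ Z T ω} ≤ Real.exp (-(T : ℝ) / 16) := by
    refine le_trans ?_ (aux_num T (K - 1) hK4)
    have := hmk.trans h4
    have e : (1 / 2 : ℝ) ^ (K - 1) * 2 ^ (K - 1) = 1 := by
      rw [← mul_pow]
      norm_num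
    calc P.real {ω | (1 / 2 : ℝ) ^ (K - 1) ≤ Z T ω}
        = ((1 / 2 : ℝ) ^ (K - 1) * P.real {ω | (1 / 2 : ℝ) ^ (K - 1) ≤ Z T ω}) * 2 ^ (K - 1) := by
          rw [mul_right_comm, e, one_mul]
      _ ≤ _ := by gcongr
  refine hle.trans ?_
  rw [← ofReal_measureReal]
  exact ENNReal.ofReal_le_ofReal hreal

/-- Multi-point form of the convergence of the non-private evolution algorithm: `N`
nonnegative adapted processes that never increase and contract by `(1-γ)` (or drop below
`η`) with conditional probability at least `1/2` given the past, are all below `η` after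
`T ≥ 16·log(N/τ)` iterations with probability at least `1 − τ`, provided
`(1-γ)^⌈T/4⌉·D ≤ η`. -/
theorem multi_contraction_process_convergence
    {Ω : Type*} {m : MeasurableSpace Ω} (P : Measure Ω) [IsProbabilityMeasure P]
    (T : ℕ) (ℱ : Filtration ℕ m) (N : ℕ) (hN : 1 ≤ N)
    (D : Fin N → ℕ → Ω → ℝ)
    (hmeas : ∀ i, ∀ t, t ≤ T → StronglyMeasurable[ℱ t] (D i t))
    (hnonneg : ∀ i, ∀ t, t ≤ T → ∀ ω, 0 ≤ D i t ω)
    (Dmax η γ τ : ℝ) (hDmax : 0 < Dmax) (hη : 0 < η) (hγ0 : 0 < γ) (hγ1 : γ < 1)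
    (hτ0 : 0 < τ) (hτ1 : τ < 1)
    (h0 : ∀ i, ∀ᵐ ω ∂P, D i 0 ω ≤ Dmax)
    (hmono : ∀ i, ∀ t, t < T → ∀ᵐ ω ∂P, D i (t + 1) ω ≤ D i t ω)
    (hcond : ∀ i, ∀ t, t < T → ∀ᵐ ω ∂P, (1 : ℝ) / 2 ≤
      (P[Set.indicator {ω' | D i (t + 1) ω' ≤ max ((1 - γ) * D i t ω') η}
          (fun _ => (1 : ℝ)) | ℱ t]) ω)
    (hcontract : (1 - γ) ^ (⌈(T : ℝ) / 4⌉₊) * Dmax ≤ η)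
    (hT : 16 * Real.log (N / τ) ≤ (T : ℝ)) :
    P {ω | ∃ i : Fin N, η < D i T ω} ≤ ENNReal.ofReal τ := by
  have hset : {ω | ∃ i : Fin N, η < D i T ω} = ⋃ i : Fin N, {ω | η < D i T ω} := by
    ext ω
    simp
  have hNpos : (0 : ℝ) < N := by exact_mod_cast hN
  have hexp : (N : ℝ) * Real.exp (-(T : ℝ) / 16) ≤ τ := by
    have h1 : Real.exp (-(T : ℝ) / 16) ≤ Real.exp (-Real.log (N / τ)) :=
      Real.exp_le_exp.2 (by linarith)
    rw [Real.exp_neg, Real.exp_log (by positivity), inv_div, le_div_iff₀ hNpos] at h1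
    linarith
  rw [hset]
  calc P (⋃ i : Fin N, {ω | η < D i T ω}) ≤ ∑ i : Fin N, P {ω | η < D i T ω} :=
        measure_iUnion_fintype_le _ _
    _ ≤ ∑ _i : Fin N, ENNReal.ofReal (Real.exp (-(T : ℝ) / 16)) :=
        Finset.sum_le_sum fun i _ => aux_single P T ℱ (D i) (hmeas i) Dmax η γ hDmax hγ0 hγ1
          (h0 i) (hmono i) (hcond i) hcontract
    _ = ENNReal.ofReal (N * Real.exp (-(T : ℝ) / 16)) := by
        rw [ENNReal.ofReal_mul hNpos.le]
        simp
    _ ≤ ENNReal.ofReal τ := ENNReal.ofReal_le_ofReal hexp
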